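/- Let x⁽⁰⁾ ∈ Kⁿ have pairwise distinct components and satisfy E_f(x⁽⁰⁾) ≤ 1/(2a + 2), where a = (n−1)^{1/q}, with strict inequality in the case n = 2 and p = ∞. Then f has n simple zeros in K, the Ehrlich iteration x⁽ᵏ⁺¹⁾ = Φ(x⁽ᵏ⁾) is well defined for all k ≥ 0 and converges to a root vector ξ of f, and for every k ≥ 0 the closed disks with centers x_i⁽ᵏ⁾ and radii r_i⁽ᵏ⁾ = (γ(E_f(x⁽ᵏ⁾))/(1 − β(E_f(x⁽ᵏ⁾))))·|W_i(x⁽ᵏ⁾)|, where γ(t) = 1/(1 − a t) and β(t) = (a t² / ((1 − a t)(1 − (a+1)t)))·(1 + a t/((n−1)(1 − (a+b)t)))^{n−1}, are mutually disjoint and each contains exactly one zero of f. (Corollary 3.5) -/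

import Mathlib

open Finset Polynomial Filter

noncomputable section

/-- The Weierstrass correction `W_i(x) = f(x_i)/(C₀ ∏_{j≠i}(x_i − x_j))`. -/
def Wc {n : ℕ} {K : Type*} [NormedField K] (f : Polynomial K) (x : Fin n → K) (i : Fin n) : K :=
  eval (x i) f / (f.leadingCoeff * ∏ j ∈ univ.erase i, (x i - x j))

/-- `dmin x i = min_{j ≠ i} ‖x i - x j‖`. -/
def dmin {n : ℕ} {K : Type*} [NormedField K] (x : Fin n → K) (i : Fin n) : ℝ :=
  if h : (univ.erase i).Nonempty then (univ.erase i).inf' h fun j => ‖x i - x j‖ else 0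

/-- `E_f(x)` : the ℓ^p norm of the vector `(‖W_i(x)‖ / d_i(x))_i`. -/
def Ef {n : ℕ} {K : Type*} [NormedField K] (p : ENNReal) (f : Polynomial K)
    (x : Fin n → K) : ℝ :=
  ‖(WithLp.equiv p (Fin n → ℝ)).symm (fun i => ‖Wc f x i‖ / dmin x i)‖

/-- `σ_i(x) = Σ_{j≠i} W_j(x)/(x_i − x_j)`. -/
def sigmaf {n : ℕ} {K : Type*} [NormedField K] (f : Polynomial K) (x : Fin n → K)
    (i : Fin n) : K :=
  ∑ j ∈ univ.erase i, Wc f x j / (x i - x j)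

/-- The Ehrlich iteration function. -/
def PhiE {n : ℕ} {K : Type*} [NormedField K] (f : Polynomial K) (x : Fin n → K) : Fin n → K :=
  fun i => x i - Wc f x i / (1 + sigmaf f x i)

/-- The Prešić–Tanabe iteration function. -/
def TnbE {n : ℕ} {K : Type*} [NormedField K] (f : Polynomial K) (x : Fin n → K) : Fin n → K :=
  fun i => x i - Wc f x i * (1 - sigmaf f x i)

/-- `ξ` is a root vector of `f`, i.e. `f(z) = C₀ ∏ (z − ξᵢ)`. -/
def IsRootVector {n : ℕ} {K : Type*} [NormedField K] (f : Polynomial K) (ξ : Fin n → K) : Prop :=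
  f = C f.leadingCoeff * ∏ i, (X - C (ξ i))

/-- `E_f(x)` in the case `p = ∞`: the max of `‖W_i(x)‖ / d_i(x)`. -/
def Einf {n : ℕ} {K : Type*} [NormedField K] (f : Polynomial K) (x : Fin n → K) : ℝ :=
  if h : (univ : Finset (Fin n)).Nonempty then univ.sup' h fun i => ‖Wc f x i‖ / dmin x i else 0

lemma Real.prod_one_add_le_one_add_sum_div_pow {ι : Type*} (s : Finset ι) (u : ι → ℝ)
    (hs : s.Nonempty) (hu : ∀ i ∈ s, 0 ≤ u i) :
    ∏ i ∈ s, (1 + u i) ≤ (1 + (∑ i ∈ s, u i) / s.card) ^ s.card := by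
  have hc : (0 : ℝ) < s.card := by exact_mod_cast hs.card_pos
  have h := Real.geom_mean_le_arith_mean_weighted s (fun _ => (s.card : ℝ)⁻¹)
    (fun i => 1 + u i) (fun _ _ => by positivity) (by simp [hc.ne'])
    (fun i hi => by linarith [hu i hi])
  rw [Real.finsetProd_rpow _ _ (fun i hi => by linarith [hu i hi])] at h
  have hP : 0 ≤ ∏ i ∈ s, (1 + u i) := prod_nonneg fun i hi => by linarith [hu i hi]
  have h2 : ∑ i ∈ s, (s.card : ℝ)⁻¹ * (1 + u i) = 1 + (∑ i ∈ s, u i) / s.card := by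
    rw [← mul_sum, sum_add_distrib, sum_const, nsmul_eq_mul]
    field_simp
  rw [h2] at h
  have := pow_le_pow_left₀ (by positivity) h s.card
  rwa [Real.rpow_inv_natCast_pow hP hs.card_pos.ne'] at this

lemma PiLp.sum_le_card_rpow_mul_norm {ι : Type*} [Fintype ι] {p q : ENNReal} (hp : 1 ≤ p)
    (hpq : p⁻¹ + q⁻¹ = 1) (v : ι → ℝ) (hv : ∀ i, 0 ≤ v i) (s : Finset ι) :
    ∑ i ∈ s, v i ≤ (s.card : ℝ) ^ (ENNReal.toReal q⁻¹) * ‖WithLp.toLp p v‖ := by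
  rcases s.eq_empty_or_nonempty with rfl | hs
  · have : Fact (1 ≤ p) := ⟨hp⟩
    simp only [sum_empty]
    positivity
  have hc : (0 : ℝ) < s.card := by exact_mod_cast hs.card_pos
  rcases eq_or_ne p ⊤ with rfl | hpt
  · have hq : q⁻¹ = 1 := by simpa using hpq
    rw [hq]
    simp only [ENNReal.toReal_one, Real.rpow_one]
    rw [← nsmul_eq_mul]
    refine sum_le_card_nsmul _ _ _ fun i _ => ?_
    exact (le_abs_self _).trans (PiLp.norm_apply_le (WithLp.toLp ⊤ v) i)
  · have h1 : 1 ≤ p.toReal := by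
      rw [← ENNReal.toReal_one]; exact ENNReal.toReal_mono hpt hp
    have hqt : q⁻¹ ≠ ⊤ := fun h => by simp [h] at hpq
    have hpi : p⁻¹ ≠ ⊤ := fun h => by simp [h] at hpq
    have hq : p.toReal⁻¹ + (q⁻¹).toReal = 1 := by
      rw [← ENNReal.toReal_inv, ← ENNReal.toReal_add hpi hqt, hpq, ENNReal.toReal_one]
    set r := p.toReal
    have hr : 0 < r := by linarith
    have hS : 0 ≤ ∑ i ∈ s, v i := sum_nonneg fun i _ => hv i
    have hSr : 0 ≤ ∑ i ∈ s, v i ^ r := sum_nonneg fun i _ => Real.rpow_nonneg (hv i) r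
    have h := Real.rpow_sum_le_const_mul_sum_rpow_of_nonneg s h1 (fun i _ => hv i)
    have h2 := Real.rpow_le_rpow (by positivity) h (inv_nonneg.2 hr.le)
    rw [Real.rpow_rpow_inv hS hr.ne', Real.mul_rpow (by positivity) hSr,
      ← Real.rpow_mul hc.le] at h2
    have he : (r - 1) * r⁻¹ = (q⁻¹).toReal := by
      rw [sub_mul, mul_inv_cancel₀ hr.ne']; linarith
    rw [he] at h2
    refine h2.trans ?_
    rw [PiLp.norm_eq_sum hr, one_div]
    gcongr ?_ * ?_ ^ _
    calc ∑ i ∈ s, v i ^ r ≤ ∑ i, v i ^ r :=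
          sum_le_sum_of_subset_of_nonneg (subset_univ s)
            fun i _ _ => Real.rpow_nonneg (hv i) r
      _ = ∑ i, ‖v i‖ ^ r := by
          refine sum_congr rfl fun i _ => ?_
          rw [Real.norm_of_nonneg (hv i)]

lemma PiLp.norm_toLp_le_mul_norm {ι : Type*} [Fintype ι] {p : ENNReal} (hp : 1 ≤ p)
    (v w : ι → ℝ) (c : ℝ) (hc : 0 ≤ c) (hv : ∀ i, 0 ≤ v i) (h : ∀ i, v i ≤ c * w i) :
    ‖WithLp.toLp p v‖ ≤ c * ‖WithLp.toLp p w‖ := by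
  have : Fact (1 ≤ p) := ⟨hp⟩
  have hcw : c * ‖WithLp.toLp p w‖ = ‖WithLp.toLp p (c • w)‖ := by
    rw [WithLp.toLp_smul, norm_smul, Real.norm_of_nonneg hc]
  have hle : ∀ i, ‖v i‖ ≤ ‖(c • w) i‖ := fun i => by
    rw [Real.norm_of_nonneg (hv i)]
    exact (h i).trans (le_abs_self _)
  rw [hcw]
  rcases eq_or_ne p ⊤ with rfl | hpt
  · rw [PiLp.norm_eq_ciSup, PiLp.norm_eq_ciSup]
    exact ciSup_mono (Set.finite_range _).bddAbove hle
  · have hr : 0 < p.toReal := ENNReal.toReal_pos (by positivity) hpt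
    rw [PiLp.norm_eq_sum hr, PiLp.norm_eq_sum hr]
    gcongr with i
    exact hle i

/-- The contraction bound `β(t) + b γ(t) t < 1` on the initial interval of the Ehrlich iteration. -/
lemma ehrlich_contraction_lt_one (m : ℕ) (hm : 1 ≤ m) (a b t : ℝ) (ha : 1 ≤ a) (hb1 : 1 ≤ b)
    (hb2 : b ≤ 2) (ht0 : 0 ≤ t) (ht : t ≤ 1 / (2 * a + 2)) (hba : 2 ≤ m → b ≤ a)
    (h1 : m = 1 → a = 1 ∧ (b < 2 ∨ t < 1 / 4)) :
    0 < 1 - (a + b) * t ∧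
    a * t ^ 2 / ((1 - a * t) * (1 - (a + 1) * t)) *
      (1 + a * t / (m * (1 - (a + b) * t))) ^ m + b * (1 / (1 - a * t)) * t < 1 := by
  have hT : t * (2 * a + 2) ≤ 1 := (le_div_iff₀ (by linarith)).1 ht
  have hz : 1 / 2 ≤ 1 - (a + 1) * t := by nlinarith
  have hx : 0 < 1 - a * t := by nlinarith
  have hat : 0 ≤ a * t := by positivity
  have hbt : b * t ≤ 2 * t := by gcongr
  have hyt : a * t ≤ 1 - (a + b) * t := by nlinarith
  have hy : 0 < 1 - (a + b) * t := by
    rcases eq_or_lt_of_le ht0 with h | h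
    · simp [← h]
    · nlinarith [mul_pos (by linarith : 0 < a) h]
  refine ⟨hy, ?_⟩
  set y := 1 - (a + b) * t with hydef
  have hm0 : (0 : ℝ) < m := by exact_mod_cast hm
  set P := (1 + a * t / (m * y)) ^ m with hP
  have hP0 : 0 ≤ P := by positivity
  have key : a * t ^ 2 * 2 * P < y := by
    rcases eq_or_lt_of_le hm with h | h
    · obtain ⟨rfl, hs⟩ := h1 h.symm
      rw [hP, ← h]
      have hy4 : 1 / 4 < y := by
        rcases hs with hs | hs
        · rcases eq_or_lt_of_le ht0 with h | h
          · rw [hydef, ← h]; norm_num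
          · nlinarith [mul_pos (sub_pos.2 hs) h]
        · nlinarith
      have : 1 * t / (((1 : ℕ) : ℝ) * y) ≤ 1 := by
        rw [div_le_one (by positivity)]; push_cast; linarith
      have h4 : t ≤ 1 / 4 := by linarith
      rw [pow_one]
      calc 1 * t ^ 2 * 2 * (1 + 1 * t / (((1 : ℕ) : ℝ) * y))
          ≤ 1 * (1 / 4) ^ 2 * 2 * (1 + 1) := by gcongr
        _ = 1 / 4 := by norm_num
        _ < y := hy4
    · have hPe : P < 3 := by
        have h3 : a * t / (m * y) ≤ 1 / m := by
          rw [div_le_div_iff₀ (by positivity) hm0]; nlinarith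
        calc P ≤ (Real.exp (1 / m)) ^ m := by
              rw [hP]
              refine pow_le_pow_left₀ (by positivity) ?_ m
              linarith [Real.add_one_le_exp (1 / (m : ℝ))]
          _ = Real.exp 1 := by
              rw [← Real.exp_nat_mul, mul_one_div_cancel hm0.ne']
          _ < 3 := Real.exp_one_lt_d9.trans (by norm_num)
      have hba := hba h
      have h6 : a * t ^ 2 * 6 ≤ y := by
        rcases le_total a 2 with h2 | h2
        · have e1 : a * t ≤ 1 / 3 := by nlinarith
          have e2 : 2 * t ≤ y := by
            nlinarith [mul_le_mul_of_nonneg_right hba ht0]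
          nlinarith
        · have e1 : t ≤ 1 / 6 := by nlinarith
          nlinarith
      rcases eq_or_lt_of_le ht0 with h0 | h0
      · rw [← h0]; simpa using hy
      · have : 0 < a * t ^ 2 * 2 := by positivity
        nlinarith
  have hz' : 0 < 1 - (a + 1) * t := by linarith
  have h2 : a * t ^ 2 / (1 - (a + 1) * t) * P < y := by
    refine lt_of_le_of_lt ?_ key
    gcongr
    rw [div_le_iff₀ hz']
    have : 0 ≤ a * t ^ 2 := by positivity
    nlinarith
  have h3 : a * t ^ 2 / ((1 - a * t) * (1 - (a + 1) * t)) * P + b * (1 / (1 - a * t)) * t =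
      (a * t ^ 2 / (1 - (a + 1) * t) * P + b * t) / (1 - a * t) := by
    field_simp
  rw [h3, div_lt_one hx]
  linarith

section Ehrlich

variable {n : ℕ} {K : Type*} [NormedField K]

lemma dmin_le (x : Fin n → K) {i j : Fin n} (hij : i ≠ j) : dmin x i ≤ ‖x i - x j‖ := by
  have hj : j ∈ univ.erase i := mem_erase.2 ⟨hij.symm, mem_univ j⟩
  rw [dmin, dif_pos ⟨j, hj⟩]
  exact inf'_le _ hj

lemma erase_univ_nonempty (hn : 2 ≤ n) (i : Fin n) : (univ.erase i).Nonempty := by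
  rw [← card_pos, card_erase_of_mem (mem_univ i), card_univ, Fintype.card_fin]
  lia

lemma le_dmin (hn : 2 ≤ n) (x : Fin n → K) (i : Fin n) {c : ℝ}
    (h : ∀ j, i ≠ j → c ≤ ‖x i - x j‖) : c ≤ dmin x i := by
  rw [dmin, dif_pos (erase_univ_nonempty hn i)]
  exact le_inf' _ _ fun j hj => h j (ne_of_mem_erase hj).symm

lemma dmin_pos (hn : 2 ≤ n) {x : Fin n → K} (hx : Function.Injective x) (i : Fin n) :
    0 < dmin x i := by
  rw [dmin, dif_pos (erase_univ_nonempty hn i), lt_inf'_iff]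
  exact fun j hj => norm_pos_iff.2 (sub_ne_zero.2 (hx.ne (ne_of_mem_erase hj).symm))

lemma prod_erase_sub_ne_zero {x : Fin n → K} (hx : Function.Injective x) (i : Fin n) :
    ∏ j ∈ univ.erase i, (x i - x j) ≠ 0 :=
  prod_ne_zero_iff.2 fun _ hj => sub_ne_zero.2 (hx.ne (ne_of_mem_erase hj).symm)

lemma eval_eq_Wc_mul {f : Polynomial K} (hf : f ≠ 0) {x : Fin n → K}
    (hx : Function.Injective x) (i : Fin n) :
    eval (x i) f = Wc f x i * (f.leadingCoeff * ∏ j ∈ univ.erase i, (x i - x j)) := by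
  rw [Wc, div_mul_cancel₀]
  exact mul_ne_zero (leadingCoeff_ne_zero.2 hf) (prod_erase_sub_ne_zero hx i)

/-- Lagrange interpolation of `f` at `x`, in terms of the Weierstrass corrections. -/
lemma eq_lagrange_Wc {f : Polynomial K} (hdeg : f.degree = n) {x : Fin n → K}
    (hx : Function.Injective x) :
    f = C f.leadingCoeff * (∏ j, (X - C (x j)) +
      ∑ i, C (Wc f x i) * ∏ j ∈ univ.erase i, (X - C (x j))) := by
  have hf : f ≠ 0 := fun h => by simp [h] at hdeg
  have hC : f.leadingCoeff ≠ 0 := leadingCoeff_ne_zero.2 hf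
  have hdP : (∏ j, (X - C (x j))).degree = (n : WithBot ℕ) := by
    rw [degree_prod]; simp
  classical
  refine eq_of_degree_sub_lt_of_eval_finset_eq (univ.image x) ?_ ?_
  · rw [card_image_of_injective _ hx, card_univ, Fintype.card_fin, mul_add, ← sub_sub]
    refine (degree_sub_le _ _).trans_lt (max_lt ?_ ?_)
    · rw [← hdeg]
      refine degree_sub_lt_left ?_ hf ?_
      · rw [degree_C_mul hC, hdP, hdeg]
      · rw [leadingCoeff_C_mul_of_isUnit hC.isUnit, (monic_prod_X_sub_C x univ).leadingCoeff,
          mul_one]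
    · rw [degree_C_mul hC]
      refine (degree_sum_le _ _).trans_lt ?_
      refine (Finset.sup_lt_iff (WithBot.bot_lt_coe n)).2 ?_
      intro i _
      rw [← smul_eq_C_mul]
      refine (degree_smul_le _ _).trans_lt ?_
      rw [degree_prod]
      simp only [degree_X_sub_C, sum_const, card_erase_of_mem (mem_univ i), card_univ,
        Fintype.card_fin, nsmul_eq_mul, mul_one]
      exact Nat.cast_lt.2 (Nat.sub_lt i.pos one_pos)
  · intro z hz
    obtain ⟨i, -, rfl⟩ := mem_image.1 hz
    have h0 : ∀ k, k ≠ i → ∏ j ∈ univ.erase k, (x i - x j) = 0 := fun k hk =>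
      prod_eq_zero (mem_erase.2 ⟨hk.symm, mem_univ i⟩) (sub_self _)
    simp only [eval_mul, eval_C, eval_add, eval_finsetSum, eval_prod, eval_sub, eval_X]
    rw [prod_eq_zero (mem_univ i) (sub_self (x i)),
      sum_eq_single i (fun k _ hk => by rw [h0 k hk, mul_zero]) (by simp),
      eval_eq_Wc_mul hf hx i]
    ring

lemma eval_eq_lagrange_Wc {f : Polynomial K} (hdeg : f.degree = n) {x : Fin n → K}
    (hx : Function.Injective x) (z : K) :
    eval z f = f.leadingCoeff * (∏ j, (z - x j) +
      ∑ i, Wc f x i * ∏ j ∈ univ.erase i, (z - x j)) := by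
  conv_lhs => rw [eq_lagrange_Wc hdeg hx]
  simp only [eval_mul, eval_C, eval_add, eval_finsetSum, eval_prod, eval_sub, eval_X]

lemma isRootVector_of_eval_eq_zero {f : Polynomial K} (hdeg : f.degree = n) {ξ : Fin n → K}
    (hξ : Function.Injective ξ) (h0 : ∀ i, eval (ξ i) f = 0) : IsRootVector f ξ := by
  have hW : ∀ i, Wc f ξ i = 0 := fun i => by rw [Wc, h0, zero_div]
  simpa [IsRootVector, hW] using eq_lagrange_Wc hdeg hξ

lemma IsRootVector.exists_eq {f : Polynomial K} (hf : f ≠ 0) {ξ : Fin n → K}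
    (h : IsRootVector f ξ) {z : K} (hz : eval z f = 0) : ∃ i, z = ξ i := by
  rw [h] at hz
  simp only [eval_mul, eval_C, eval_prod, eval_sub, eval_X, mul_eq_zero,
    leadingCoeff_eq_zero, hf, false_or, prod_eq_zero_iff, mem_univ, true_and,
    sub_eq_zero] at hz
  exact hz

/-- The value of `f` at an Ehrlich iterate. -/
lemma eval_PhiE {f : Polynomial K} (hdeg : f.degree = n) {x : Fin n → K}
    (hx : Function.Injective x) (i : Fin n) (hσ : 1 + sigmaf f x i ≠ 0)
    (hne : ∀ j, i ≠ j → PhiE f x i ≠ x j) :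
    eval (PhiE f x i) f = f.leadingCoeff * (-((PhiE f x i - x i) ^ 2 *
      (∑ j ∈ univ.erase i, Wc f x j / ((PhiE f x i - x j) * (x i - x j))) *
      ∏ j ∈ univ.erase i, (PhiE f x i - x j))) := by
  set z := PhiE f x i with hz
  have hW : Wc f x i = -(z - x i) * (1 + sigmaf f x i) := by
    rw [hz, PhiE]; field_simp; ring
  set P := ∏ j ∈ univ.erase i, (z - x j) with hP
  rw [eval_eq_lagrange_Wc hdeg hx]
  congr 1
  rw [← mul_prod_erase univ (fun j => z - x j) (mem_univ i),
    ← add_sum_erase univ _ (mem_univ i), hW, ← hP]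
  have hsum : ∑ k ∈ univ.erase i, Wc f x k * ∏ j ∈ univ.erase k, (z - x j) =
      (z - x i) * P * ∑ k ∈ univ.erase i, Wc f x k / (z - x k) := by
    rw [mul_sum]
    refine sum_congr rfl fun k hk => ?_
    have hk' := ne_of_mem_erase hk
    have h1 : (z - x i) * P = (z - x k) * ∏ j ∈ univ.erase k, (z - x j) := by
      rw [mul_prod_erase univ (fun j => z - x j) (mem_univ k),
        hP, mul_prod_erase univ (fun j => z - x j) (mem_univ i)]
    have h2 : z - x k ≠ 0 := sub_ne_zero.2 (hne k hk'.symm)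
    rw [h1]; field_simp
  have hdiff : ∑ k ∈ univ.erase i, Wc f x k / (z - x k) = sigmaf f x i -
      (z - x i) * ∑ j ∈ univ.erase i, Wc f x j / ((z - x j) * (x i - x j)) := by
    rw [sigmaf, mul_sum, ← sum_sub_distrib]
    refine sum_congr rfl fun k hk => ?_
    have hk' := ne_of_mem_erase hk
    have h2 : z - x k ≠ 0 := sub_ne_zero.2 (hne k hk'.symm)
    have h3 : x i - x k ≠ 0 := sub_ne_zero.2 (hx.ne hk'.symm)
    field_simp
    ring
  rw [hsum, hdiff]
  ring

lemma norm_Wc_le (hn : 2 ≤ n) (f : Polynomial K) {x : Fin n → K} (hx : Function.Injective x)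
    {i j : Fin n} (hij : i ≠ j) :
    ‖Wc f x i‖ ≤ ‖Wc f x i‖ / dmin x i * ‖x i - x j‖ := by
  have hd := dmin_pos hn hx i
  calc ‖Wc f x i‖ = ‖Wc f x i‖ / dmin x i * dmin x i := (div_mul_cancel₀ _ hd.ne').symm
    _ ≤ _ := by gcongr; exact dmin_le x hij

/-- `x` satisfies the bounds that Hölder's inequality yields from `E_f(x) ≤ t`. -/
structure WcBounds (f : Polynomial K) (x : Fin n → K) (a b t : ℝ) : Prop where
  le : ∀ i, ‖Wc f x i‖ / dmin x i ≤ t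
  add_le : ∀ i j, i ≠ j → ‖Wc f x i‖ / dmin x i + ‖Wc f x j‖ / dmin x j ≤ b * t
  sum_le : ∀ i, ∑ j ∈ univ.erase i, ‖Wc f x j‖ / dmin x j ≤ a * t

lemma WcBounds.norm_Wc_add_le {f : Polynomial K} {x : Fin n → K} {a b t : ℝ}
    (h : WcBounds f x a b t) (hn : 2 ≤ n) (hx : Function.Injective x) {i j : Fin n}
    (hij : i ≠ j) : ‖Wc f x i‖ + ‖Wc f x j‖ ≤ b * t * ‖x i - x j‖ := by
  have h1 := norm_Wc_le hn f hx hij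
  have h2 := norm_Wc_le hn f hx hij.symm
  rw [norm_sub_rev] at h2
  nlinarith [mul_le_mul_of_nonneg_right (h.add_le i j hij) (norm_nonneg (x i - x j))]

lemma WcBounds.norm_sigmaf_le {f : Polynomial K} {x : Fin n → K} {a b t : ℝ}
    (h : WcBounds f x a b t) (hn : 2 ≤ n) (hx : Function.Injective x) (i : Fin n) :
    ‖sigmaf f x i‖ ≤ a * t := by
  refine (norm_sum_le _ _).trans ((sum_le_sum fun j hj => ?_).trans (h.sum_le i))
  have hji := ne_of_mem_erase hj
  have := dmin_pos hn hx j
  rw [norm_div, norm_sub_rev]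
  gcongr
  exact dmin_le x hji

lemma WcBounds.le_norm_one_add_sigmaf {f : Polynomial K} {x : Fin n → K} {a b t : ℝ}
    (h : WcBounds f x a b t) (hn : 2 ≤ n) (hx : Function.Injective x) (i : Fin n) :
    1 - a * t ≤ ‖1 + sigmaf f x i‖ := by
  have h1 := h.norm_sigmaf_le hn hx i
  have h2 := norm_sub_le_norm_add (1 : K) (sigmaf f x i)
  rw [norm_one] at h2
  linarith

lemma WcBounds.norm_PhiE_sub_le {f : Polynomial K} {x : Fin n → K} {a b t : ℝ}
    (h : WcBounds f x a b t) (hn : 2 ≤ n) (hx : Function.Injective x) (hat : a * t < 1)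
    (i : Fin n) : ‖PhiE f x i - x i‖ ≤ 1 / (1 - a * t) * ‖Wc f x i‖ := by
  have h1 := h.le_norm_one_add_sigmaf hn hx i
  have h2 : 0 < 1 - a * t := by linarith
  have h3 : PhiE f x i - x i = -(Wc f x i / (1 + sigmaf f x i)) := by rw [PhiE]; ring
  rw [h3, norm_neg, norm_div, one_div_mul_eq_div]
  gcongr

lemma WcBounds.le_norm_PhiE_sub_PhiE {f : Polynomial K} {x : Fin n → K} {a b t : ℝ}
    (h : WcBounds f x a b t) (hn : 2 ≤ n) (hx : Function.Injective x) (hat : a * t < 1)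
    {i j : Fin n} (hij : i ≠ j) :
    (1 - b * (1 / (1 - a * t)) * t) * ‖x i - x j‖ ≤ ‖PhiE f x i - PhiE f x j‖ := by
  have h1 := h.norm_PhiE_sub_le hn hx hat i
  have h2 := h.norm_PhiE_sub_le hn hx hat j
  have h3 := h.norm_Wc_add_le hn hx hij
  have hg : 0 ≤ 1 / (1 - a * t) := one_div_nonneg.2 (by linarith)
  have h4 := mul_le_mul_of_nonneg_left h3 hg
  have h5 : ‖x i - x j‖ ≤
      ‖PhiE f x i - PhiE f x j‖ + ‖PhiE f x i - x i‖ + ‖PhiE f x j - x j‖ := by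
    have : x i - x j =
        PhiE f x i - PhiE f x j - (PhiE f x i - x i) + (PhiE f x j - x j) := by ring
    calc ‖x i - x j‖ = _ := by rw [this]
      _ ≤ _ := (norm_add_le _ _).trans (by gcongr; exact norm_sub_le _ _)
  nlinarith

lemma WcBounds.le_norm_PhiE_sub {f : Polynomial K} {x : Fin n → K} {a b t : ℝ}
    (h : WcBounds f x a b t) (hn : 2 ≤ n) (hx : Function.Injective x) (hat : a * t < 1)
    {i j : Fin n} (hij : i ≠ j) :
    (1 - 1 / (1 - a * t) * t) * ‖x i - x j‖ ≤ ‖PhiE f x i - x j‖ := by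
  have h1 := h.norm_PhiE_sub_le hn hx hat i
  have h2 := (norm_Wc_le hn f hx hij).trans
    (mul_le_mul_of_nonneg_right (h.le i) (norm_nonneg (x i - x j)))
  have hg : 0 ≤ 1 / (1 - a * t) := one_div_nonneg.2 (by linarith)
  have h4 := mul_le_mul_of_nonneg_left h2 hg
  have h5 : ‖x i - x j‖ ≤ ‖PhiE f x i - x j‖ + ‖PhiE f x i - x i‖ := by
    rw [norm_sub_rev (PhiE f x i) (x i), add_comm]
    exact norm_sub_le_norm_sub_add_norm_sub _ _ _
  nlinarith

lemma WcBounds.norm_Wc_PhiE_le {f : Polynomial K} {x : Fin n → K} {a b t : ℝ}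
    (h : WcBounds f x a b t) (hn : 2 ≤ n) (hdeg : f.degree = n) (hx : Function.Injective x)
    (ht : 0 ≤ t) (ha : 0 ≤ a) (hb : 1 ≤ b) (hy : 0 < 1 - (a + b) * t) (i : Fin n) :
    ‖Wc f (PhiE f x) i‖ ≤ a * t ^ 2 / ((1 - a * t) * (1 - (a + 1) * t)) *
      (1 + a * t / (((n : ℝ) - 1) * (1 - (a + b) * t))) ^ (n - 1) * ‖Wc f x i‖ := by
  have hf : f ≠ 0 := fun h => by simp [h] at hdeg
  have hC : f.leadingCoeff ≠ 0 := leadingCoeff_ne_zero.2 hf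
  have hz : 0 < 1 - (a + 1) * t := by nlinarith
  have hat : 0 < 1 - a * t := by nlinarith
  have hat' : a * t < 1 := by linarith
  have hcard : (univ.erase i).card = n - 1 := by
    rw [card_erase_of_mem (mem_univ i), card_univ, Fintype.card_fin]
  have hn1 : ((n - 1 : ℕ) : ℝ) = (n : ℝ) - 1 := by rw [Nat.cast_sub (by lia)]; simp
  have hn0 : (0 : ℝ) < (n : ℝ) - 1 := by rw [← hn1]; exact_mod_cast (by lia : 0 < n - 1)
  set g := 1 / (1 - a * t) with hg
  have hg0 : 0 < g := by positivity
  have hgt : 1 - g * t = (1 - (a + 1) * t) / (1 - a * t) := by rw [hg]; field_simp; ring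
  have hbt : 1 - b * g * t = (1 - (a + b) * t) / (1 - a * t) := by rw [hg]; field_simp; ring
  have hgt0 : 0 < 1 - g * t := by rw [hgt]; positivity
  have hbt0 : 0 < 1 - b * g * t := by rw [hbt]; positivity
  have hxpos : ∀ j, j ≠ i → 0 < ‖x i - x j‖ := fun j hj =>
    norm_pos_iff.2 (sub_ne_zero.2 (hx.ne hj.symm))
  have hzx : ∀ j, j ≠ i → (1 - g * t) * ‖x i - x j‖ ≤ ‖PhiE f x i - x j‖ := fun j hj =>
    h.le_norm_PhiE_sub hn hx hat' hj.symm
  have hzz : ∀ j, j ≠ i → (1 - b * g * t) * ‖x i - x j‖ ≤ ‖PhiE f x i - PhiE f x j‖ :=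
    fun j hj => h.le_norm_PhiE_sub_PhiE hn hx hat' hj.symm
  have hσ : 1 + sigmaf f x i ≠ 0 :=
    norm_pos_iff.1 (hat.trans_le (h.le_norm_one_add_sigmaf hn hx i))
  have hne : ∀ j, i ≠ j → PhiE f x i ≠ x j := fun j hj => sub_ne_zero.1 <| norm_pos_iff.1 <|
    (mul_pos hgt0 (hxpos j hj.symm)).trans_le (hzx j hj.symm)
  have hW : ‖Wc f (PhiE f x) i‖ = ‖PhiE f x i - x i‖ ^ 2 *
      ‖∑ j ∈ univ.erase i, Wc f x j / ((PhiE f x i - x j) * (x i - x j))‖ *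
      ∏ j ∈ univ.erase i, (‖PhiE f x i - x j‖ / ‖PhiE f x i - PhiE f x j‖) := by
    rw [Wc, eval_PhiE hdeg hx i hσ hne, mul_div_mul_left _ _ hC, norm_div, norm_neg, norm_mul,
      norm_mul, norm_pow, norm_prod, norm_prod, prod_div_distrib, mul_div_assoc]
  have hd := dmin_pos hn hx i
  have hsum : ‖∑ j ∈ univ.erase i, Wc f x j / ((PhiE f x i - x j) * (x i - x j))‖ ≤
      a * t / ((1 - g * t) * dmin x i) := by
    calc _ ≤ ∑ j ∈ univ.erase i, ‖Wc f x j‖ / dmin x j / ((1 - g * t) * dmin x i) := by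
          refine (norm_sum_le _ _).trans (sum_le_sum fun j hj => ?_)
          have hji := ne_of_mem_erase hj
          have hp := hxpos j hji
          have h1 := norm_Wc_le hn f hx hji
          rw [norm_sub_rev] at h1
          have hdj := dmin_pos hn hx j
          calc ‖Wc f x j / ((PhiE f x i - x j) * (x i - x j))‖
              = ‖Wc f x j‖ / (‖PhiE f x i - x j‖ * ‖x i - x j‖) := by rw [norm_div, norm_mul]
            _ ≤ (‖Wc f x j‖ / dmin x j * ‖x i - x j‖) /
                ((1 - g * t) * dmin x i * ‖x i - x j‖) := by
                gcongr
                calc (1 - g * t) * dmin x i ≤ (1 - g * t) * ‖x i - x j‖ := by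
                      gcongr; exact dmin_le x hji.symm
                  _ ≤ _ := hzx j hji
            _ = _ := by field_simp
      _ = (∑ j ∈ univ.erase i, ‖Wc f x j‖ / dmin x j) / ((1 - g * t) * dmin x i) := by
          rw [sum_div]
      _ ≤ _ := by gcongr; exact h.sum_le i
  have hprod : ∏ j ∈ univ.erase i, (‖PhiE f x i - x j‖ / ‖PhiE f x i - PhiE f x j‖) ≤
      (1 + a * t / (((n : ℝ) - 1) * (1 - (a + b) * t))) ^ (n - 1) := by
    have hu : ∀ j ∈ univ.erase i, 0 ≤ ‖Wc f x j‖ / dmin x j * (g / (1 - b * g * t)) :=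
      fun j _ => mul_nonneg (div_nonneg (norm_nonneg _) (dmin_pos hn hx j).le) (by positivity)
    calc _ ≤ ∏ j ∈ univ.erase i, (1 + ‖Wc f x j‖ / dmin x j * (g / (1 - b * g * t))) := by
          refine prod_le_prod (fun _ _ => by positivity) fun j hj => ?_
          have hji := ne_of_mem_erase hj
          have hp := hxpos j hji
          have hq := hzz j hji
          have hq0 : 0 < ‖PhiE f x i - PhiE f x j‖ := (mul_pos hbt0 hp).trans_le hq
          have h1 := norm_Wc_le hn f hx hji
          rw [norm_sub_rev] at h1
          have h2 := h.norm_PhiE_sub_le hn hx hat' j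
          have h3 : ‖PhiE f x i - x j‖ ≤ ‖PhiE f x i - PhiE f x j‖ + ‖PhiE f x j - x j‖ :=
            norm_sub_le_norm_sub_add_norm_sub _ _ _
          have hdj := dmin_pos hn hx j
          calc _ ≤ (‖PhiE f x i - PhiE f x j‖ + ‖PhiE f x j - x j‖) /
                ‖PhiE f x i - PhiE f x j‖ := by gcongr
            _ = 1 + ‖PhiE f x j - x j‖ / ‖PhiE f x i - PhiE f x j‖ := by field_simp
            _ ≤ 1 + (g * (‖Wc f x j‖ / dmin x j * ‖x i - x j‖)) /
                ((1 - b * g * t) * ‖x i - x j‖) := by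
                gcongr
                exact h2.trans (by gcongr)
            _ = _ := by field_simp
      _ ≤ _ := Real.prod_one_add_le_one_add_sum_div_pow _ _ (erase_univ_nonempty hn i) hu
      _ ≤ (1 + (a * t * (g / (1 - b * g * t))) / (n - 1 : ℕ)) ^ (n - 1) := by
          rw [hcard, ← sum_mul]
          gcongr
          · exact add_nonneg zero_le_one (div_nonneg (by rw [sum_mul]; exact sum_nonneg hu)
              (Nat.cast_nonneg _))
          · exact h.sum_le i
      _ = _ := by
          rw [hn1, hbt, hg]
          congr 2
          field_simp
  rw [hW]
  have hP0 : 0 ≤ (1 + a * t / (((n : ℝ) - 1) * (1 - (a + b) * t))) ^ (n - 1) := by positivity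
  have hWi : ‖Wc f x i‖ ≤ t * dmin x i := (div_le_iff₀ hd).1 (h.le i)
  have hsq : ‖PhiE f x i - x i‖ ^ 2 ≤ g ^ 2 * (t * dmin x i) * ‖Wc f x i‖ := by
    calc ‖PhiE f x i - x i‖ ^ 2 ≤ (g * ‖Wc f x i‖) ^ 2 := by
          gcongr; exact h.norm_PhiE_sub_le hn hx hat' i
      _ = g ^ 2 * ‖Wc f x i‖ * ‖Wc f x i‖ := by ring
      _ ≤ _ := by gcongr
  calc _ ≤ (g ^ 2 * (t * dmin x i) * ‖Wc f x i‖) * (a * t / ((1 - g * t) * dmin x i)) *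
        (1 + a * t / (((n : ℝ) - 1) * (1 - (a + b) * t))) ^ (n - 1) := by
        gcongr
    _ = _ := by
        rw [hgt, hg]
        field_simp

lemma Ef_nonneg {p : ENNReal} (hp : 1 ≤ p) (f : Polynomial K) (x : Fin n → K) :
    0 ≤ Ef p f x := by
  have : Fact (1 ≤ p) := ⟨hp⟩
  exact norm_nonneg _

lemma wcBounds_Ef (hn : 2 ≤ n) {p q : ENNReal} (hp : 1 ≤ p) (hpq : p⁻¹ + q⁻¹ = 1)
    (f : Polynomial K) {x : Fin n → K} (hx : Function.Injective x) {t : ℝ}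
    (hE : Ef p f x ≤ t) :
    WcBounds f x (((n : ℝ) - 1) ^ (ENNReal.toReal q⁻¹)) ((2 : ℝ) ^ (ENNReal.toReal q⁻¹)) t := by
  have hv : ∀ i, 0 ≤ ‖Wc f x i‖ / dmin x i := fun i =>
    div_nonneg (norm_nonneg _) (dmin_pos hn hx i).le
  have key := fun s : Finset (Fin n) =>
    (PiLp.sum_le_card_rpow_mul_norm hp hpq (fun i => ‖Wc f x i‖ / dmin x i) hv s).trans
      (mul_le_mul_of_nonneg_left hE (by positivity))
  refine ⟨fun i => ?_, fun i j hij => ?_, fun i => ?_⟩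
  · simpa using key {i}
  · simpa [sum_pair hij, card_pair hij] using key {i, j}
  · have h := key (univ.erase i)
    rwa [card_erase_of_mem (mem_univ i), card_univ, Fintype.card_fin,
      Nat.cast_sub (by lia), Nat.cast_one] at h

/-- The data making the Ehrlich iteration contractive on `{x | E_f(x) ≤ t}`. -/
structure EhrlichContraction (n : ℕ) (a b t g B : ℝ) : Prop where
  t_nonneg : 0 ≤ t
  a_nonneg : 0 ≤ a
  one_le_b : 1 ≤ b
  pos : 0 < 1 - (a + b) * t
  g_eq : g = 1 / (1 - a * t)
  B_eq : B = a * t ^ 2 / ((1 - a * t) * (1 - (a + 1) * t)) *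
      (1 + a * t / (((n : ℝ) - 1) * (1 - (a + b) * t))) ^ (n - 1)
  lt_one : B + b * g * t < 1

namespace EhrlichContraction

variable {a b t g B : ℝ}

lemma at_lt (h : EhrlichContraction n a b t g B) : a * t < 1 := by
  nlinarith [h.pos, h.t_nonneg, h.one_le_b]

lemma g_pos (h : EhrlichContraction n a b t g B) : 0 < g := by
  rw [h.g_eq]
  exact one_div_pos.2 (by linarith [h.at_lt])

lemma bgt_nonneg (h : EhrlichContraction n a b t g B) : 0 ≤ b * g * t :=
  mul_nonneg (mul_nonneg (by linarith [h.one_le_b]) h.g_pos.le) h.t_nonneg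

lemma B_lt_one (h : EhrlichContraction n a b t g B) : B < 1 := by
  linarith [h.lt_one, h.bgt_nonneg]

lemma B_nonneg (hn : 2 ≤ n) (h : EhrlichContraction n a b t g B) : 0 ≤ B := by
  have h1 := h.at_lt
  have h2 : 0 < 1 - (a + 1) * t := by nlinarith [h.pos, h.t_nonneg, h.one_le_b]
  have hn' : (2 : ℝ) ≤ n := by exact_mod_cast hn
  have := h.pos
  have := h.t_nonneg
  have := h.a_nonneg
  have : 0 < 1 - a * t := by linarith
  have : 0 < (n : ℝ) - 1 := by linarith
  rw [h.B_eq]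
  positivity

lemma injective_PhiE (h : EhrlichContraction n a b t g B) (hn : 2 ≤ n) {f : Polynomial K}
    {x : Fin n → K} (hx : Function.Injective x) (hW : WcBounds f x a b t) :
    Function.Injective (PhiE f x) := by
  intro i j hij
  by_contra hne
  have h1 := hW.le_norm_PhiE_sub_PhiE hn hx h.at_lt hne
  rw [← h.g_eq, hij, sub_self, norm_zero] at h1
  have h2 : 0 < ‖x i - x j‖ := norm_pos_iff.2 (sub_ne_zero.2 (hx.ne hne))
  nlinarith [h.lt_one, h.B_nonneg hn]

lemma norm_Wc_PhiE_le (h : EhrlichContraction n a b t g B) (hn : 2 ≤ n) {f : Polynomial K}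
    (hdeg : f.degree = n) {x : Fin n → K} (hx : Function.Injective x)
    (hW : WcBounds f x a b t) (i : Fin n) : ‖Wc f (PhiE f x) i‖ ≤ B * ‖Wc f x i‖ := by
  rw [h.B_eq]
  exact hW.norm_Wc_PhiE_le hn hdeg hx h.t_nonneg h.a_nonneg h.one_le_b h.pos i

lemma Ef_PhiE_le (h : EhrlichContraction n a b t g B) (hn : 2 ≤ n) {f : Polynomial K}
    (hdeg : f.degree = n) {x : Fin n → K} (hx : Function.Injective x)
    (hW : WcBounds f x a b t) {p : ENNReal} (hp : 1 ≤ p) : Ef p f (PhiE f x) ≤ Ef p f x := by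
  have hx' := h.injective_PhiE hn hx hW
  have hB := h.B_nonneg hn
  have key : ∀ i, ‖Wc f (PhiE f x) i‖ / dmin (PhiE f x) i ≤ 1 * (‖Wc f x i‖ / dmin x i) := by
    intro i
    have hd := dmin_pos hn hx i
    have hd' := dmin_pos hn hx' i
    have h1 : (1 - b * g * t) * dmin x i ≤ dmin (PhiE f x) i := by
      refine le_dmin hn _ i fun j hij => ?_
      refine le_trans ?_ (h.g_eq ▸ hW.le_norm_PhiE_sub_PhiE hn hx h.at_lt hij)
      have := h.lt_one
      exact mul_le_mul_of_nonneg_left (dmin_le x hij) (by linarith)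
    have h2 := h.norm_Wc_PhiE_le hn hdeg hx hW i
    rw [one_mul, div_le_div_iff₀ hd' hd]
    calc ‖Wc f (PhiE f x) i‖ * dmin x i ≤ B * ‖Wc f x i‖ * dmin x i := by gcongr
      _ = ‖Wc f x i‖ * (B * dmin x i) := by ring
      _ ≤ ‖Wc f x i‖ * ((1 - b * g * t) * dmin x i) := by
          gcongr; linarith [h.lt_one]
      _ ≤ _ := by gcongr
  have := PiLp.norm_toLp_le_mul_norm hp _ _ 1 zero_le_one
    (fun i => div_nonneg (norm_nonneg _) (dmin_pos hn hx' i).le) key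
  rwa [one_mul] at this

lemma disjoint_closedBall (h : EhrlichContraction n a b t g B) (hn : 2 ≤ n)
    {f : Polynomial K} {x : Fin n → K} (hx : Function.Injective x) (hW : WcBounds f x a b t)
    {i j : Fin n} (hij : i ≠ j) :
    Disjoint (Metric.closedBall (x i) (g / (1 - B) * ‖Wc f x i‖))
      (Metric.closedBall (x j) (g / (1 - B) * ‖Wc f x j‖)) := by
  refine Metric.closedBall_disjoint_closedBall ?_
  rw [dist_eq_norm, ← mul_add]
  have h1 : 0 < ‖x i - x j‖ := norm_pos_iff.2 (sub_ne_zero.2 (hx.ne hij))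
  have h2 : 0 < 1 - B := by linarith [h.B_lt_one]
  have hg := h.g_pos
  calc g / (1 - B) * (‖Wc f x i‖ + ‖Wc f x j‖) ≤ g / (1 - B) * (b * t * ‖x i - x j‖) := by
        gcongr; exact hW.norm_Wc_add_le hn hx hij
    _ = b * g * t / (1 - B) * ‖x i - x j‖ := by ring
    _ < 1 * ‖x i - x j‖ := by
        gcongr
        rw [div_lt_one h2]
        linarith [h.lt_one]
    _ = _ := one_mul _

end EhrlichContraction

section Convergence

variable {a b t g B : ℝ} {p q : ENNReal} {f : Polynomial K} {x : Fin n → K}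

lemma EhrlichContraction.iterate (h : EhrlichContraction n a b t g B) (hn : 2 ≤ n)
    (hdeg : f.degree = n) (hp : 1 ≤ p)
    (hW : ∀ y : Fin n → K, Function.Injective y → Ef p f y ≤ t → WcBounds f y a b t)
    (hx : Function.Injective x) (hE : Ef p f x ≤ t) (k : ℕ) :
    Function.Injective ((PhiE f)^[k] x) ∧ Ef p f ((PhiE f)^[k] x) ≤ Ef p f x ∧
      ∀ i, ‖Wc f ((PhiE f)^[k] x) i‖ ≤ B ^ k * ‖Wc f x i‖ := by
  induction k with
  | zero => simpa using hx
  | succ k ih =>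
    obtain ⟨h1, h2, h3⟩ := ih
    have hWk := hW _ h1 (h2.trans hE)
    rw [Function.iterate_succ_apply']
    refine ⟨h.injective_PhiE hn h1 hWk, (h.Ef_PhiE_le hn hdeg h1 hWk hp).trans h2, fun i => ?_⟩
    have hB := h.B_nonneg hn
    calc _ ≤ B * ‖Wc f ((PhiE f)^[k] x) i‖ := h.norm_Wc_PhiE_le hn hdeg h1 hWk i
      _ ≤ B * (B ^ k * ‖Wc f x i‖) := by gcongr; exact h3 i
      _ = _ := by ring

lemma EhrlichContraction.exists_tendsto [CompleteSpace K] (h : EhrlichContraction n a b t g B)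
    (hn : 2 ≤ n) (hdeg : f.degree = n) (hp : 1 ≤ p)
    (hW : ∀ y : Fin n → K, Function.Injective y → Ef p f y ≤ t → WcBounds f y a b t)
    (hx : Function.Injective x) (hE : Ef p f x ≤ t) :
    ∃ ξ : Fin n → K, Function.Injective ξ ∧ IsRootVector f ξ ∧
      Tendsto (fun k => (PhiE f)^[k] x) atTop (nhds ξ) ∧
      ∀ i, ξ i ∈ Metric.closedBall (x i) (g / (1 - B) * ‖Wc f x i‖) := by
  have hf : f ≠ 0 := fun h => by simp [h] at hdeg
  have hit := h.iterate hn hdeg hp hW hx hE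
  have hB := h.B_nonneg hn
  have hg := h.g_pos
  have hdist : ∀ i k, dist ((PhiE f)^[k] x i) ((PhiE f)^[k + 1] x i) ≤
      g * ‖Wc f x i‖ * B ^ k := by
    intro i k
    obtain ⟨h1, h2, h3⟩ := hit k
    rw [Function.iterate_succ_apply', dist_comm, dist_eq_norm]
    calc _ ≤ g * ‖Wc f ((PhiE f)^[k] x) i‖ :=
          h.g_eq ▸ (hW _ h1 (h2.trans hE)).norm_PhiE_sub_le hn h1 h.at_lt i
      _ ≤ g * (B ^ k * ‖Wc f x i‖) := by gcongr; exact h3 i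
      _ = _ := by ring
  choose ξ hξ using fun i => cauchySeq_tendsto_of_complete
    (cauchySeq_of_le_geometric B _ h.B_lt_one (hdist i))
  have hmem : ∀ i, ξ i ∈ Metric.closedBall (x i) (g / (1 - B) * ‖Wc f x i‖) := fun i => by
    rw [Metric.mem_closedBall, dist_comm]
    refine (dist_le_of_le_geometric_of_tendsto₀ B _ h.B_lt_one (hdist i) (hξ i)).trans_eq ?_
    ring
  have hinj : Function.Injective ξ := by
    intro i j hij
    by_contra hne
    exact Set.disjoint_left.1 (h.disjoint_closedBall hn hx (hW x hx hE) hne) (hmem i)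
      (hij ▸ hmem j)
  refine ⟨ξ, hinj, isRootVector_of_eval_eq_zero hdeg hinj fun i => ?_,
    tendsto_pi_nhds.2 hξ, hmem⟩
  have hWlim : Tendsto (fun k => Wc f ((PhiE f)^[k] x) i) atTop (nhds 0) := by
    refine squeeze_zero_norm (fun k => (hit k).2.2 i) ?_
    simpa using (tendsto_pow_atTop_nhds_zero_of_lt_one hB h.B_lt_one).mul_const ‖Wc f x i‖
  have h1 : Tendsto (fun k => eval ((PhiE f)^[k] x i) f) atTop (nhds (eval (ξ i) f)) :=
    (f.continuous.tendsto _).comp (hξ i)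
  have h2 : Tendsto (fun k => Wc f ((PhiE f)^[k] x) i * (f.leadingCoeff *
      ∏ j ∈ univ.erase i, ((PhiE f)^[k] x i - (PhiE f)^[k] x j))) atTop
      (nhds (0 * (f.leadingCoeff * ∏ j ∈ univ.erase i, (ξ i - ξ j)))) :=
    hWlim.mul (tendsto_const_nhds.mul (tendsto_finsetProd _ fun j _ => (hξ i).sub (hξ j)))
  rw [zero_mul] at h2
  exact tendsto_nhds_unique h1 (h2.congr fun k => (eval_eq_Wc_mul hf (hit k).1 i).symm)

end Convergence

end Ehrlich

/-- Proinov, Corollary 3.5. -/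
theorem stmt_13 {n : ℕ} {K : Type*} [NormedField K] [CompleteSpace K] (hn : 2 ≤ n)
    (f : Polynomial K) (hdeg : f.degree = (n : ℕ))
    (p q : ENNReal) (hp : 1 ≤ p) (hpq : p⁻¹ + q⁻¹ = 1)
    (a b : ℝ) (ha : a = ((n : ℝ) - 1) ^ (ENNReal.toReal q⁻¹))
    (hb : b = (2 : ℝ) ^ (ENNReal.toReal q⁻¹))
    (γ β : ℝ → ℝ)
    (hγ : ∀ t, γ t = 1 / (1 - a * t))
    (hβ : ∀ t, β t = a * t ^ 2 / ((1 - a * t) * (1 - (a + 1) * t)) *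
      (1 + a * t / (((n : ℝ) - 1) * (1 - (a + b) * t))) ^ (n - 1))
    (x0 : Fin n → K) (hx0 : Function.Injective x0)
    (hE0 : Ef p f x0 ≤ 1 / (2 * a + 2))
    (hstrict : n = 2 → p = ⊤ → Ef p f x0 < 1 / (2 * a + 2)) :
    (∃ ζ : Fin n → K, Function.Injective ζ ∧ IsRootVector f ζ) ∧
    (∀ k : ℕ, Function.Injective ((PhiE f)^[k] x0) ∧
      ∀ i : Fin n, (1 : K) + sigmaf f ((PhiE f)^[k] x0) i ≠ 0) ∧
    (∃ ξ : Fin n → K, IsRootVector f ξ ∧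
      Tendsto (fun k => (PhiE f)^[k] x0) atTop (nhds ξ)) ∧
    ∀ k : ℕ,
      (∀ i j : Fin n, i ≠ j →
        Disjoint
          (Metric.closedBall ((PhiE f)^[k] x0 i)
            (γ (Ef p f ((PhiE f)^[k] x0)) / (1 - β (Ef p f ((PhiE f)^[k] x0))) *
              ‖Wc f ((PhiE f)^[k] x0) i‖))
          (Metric.closedBall ((PhiE f)^[k] x0 j)
            (γ (Ef p f ((PhiE f)^[k] x0)) / (1 - β (Ef p f ((PhiE f)^[k] x0))) *
              ‖Wc f ((PhiE f)^[k] x0) j‖))) ∧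
      (∀ i : Fin n, ∃! z : K,
        z ∈ Metric.closedBall ((PhiE f)^[k] x0 i)
          (γ (Ef p f ((PhiE f)^[k] x0)) / (1 - β (Ef p f ((PhiE f)^[k] x0))) *
            ‖Wc f ((PhiE f)^[k] x0) i‖) ∧
        eval z f = 0) := by
  have hn1 : ((n - 1 : ℕ) : ℝ) = (n : ℝ) - 1 := by rw [Nat.cast_sub (by lia)]; simp
  have hm : (1 : ℝ) ≤ (n : ℝ) - 1 := by rw [← hn1]; exact_mod_cast (by lia : 1 ≤ n - 1)
  have hpi : p⁻¹ ≠ ⊤ := fun h => by simp [h] at hpq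
  have hqi : q⁻¹ ≠ ⊤ := fun h => by simp [h] at hpq
  have hs0 : 0 ≤ (q⁻¹).toReal := ENNReal.toReal_nonneg
  have hs : (p⁻¹).toReal + (q⁻¹).toReal = 1 := by
    rw [← ENNReal.toReal_add hpi hqi, hpq, ENNReal.toReal_one]
  have hs1 : (q⁻¹).toReal ≤ 1 := by linarith [ENNReal.toReal_nonneg (a := p⁻¹)]
  have ha1 : 1 ≤ a := ha ▸ Real.one_le_rpow hm hs0
  have hb1 : 1 ≤ b := hb ▸ Real.one_le_rpow one_le_two hs0
  have hb2 : b ≤ 2 := by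
    rw [hb]
    calc (2 : ℝ) ^ (q⁻¹).toReal ≤ 2 ^ (1 : ℝ) := Real.rpow_le_rpow_of_exponent_le one_le_two hs1
      _ = 2 := Real.rpow_one 2
  have hcontr : ∀ t, 0 ≤ t → t ≤ Ef p f x0 → EhrlichContraction n a b t (γ t) (β t) := by
    intro t ht0 ht
    obtain ⟨hpos, hlt⟩ := ehrlich_contraction_lt_one (n - 1) (by lia) a b t ha1 hb1 hb2 ht0
      (ht.trans hE0)
      (fun h2 => by
        rw [ha, hb, ← hn1]
        exact Real.rpow_le_rpow zero_le_two (by exact_mod_cast h2) hs0)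
      (fun h1 => by
        have hn2 : n = 2 := by lia
        have ha2 : a = 1 := by rw [ha, ← hn1, h1, Nat.cast_one, Real.one_rpow]
        refine ⟨ha2, ?_⟩
        by_cases hpt : p = ⊤
        · have h := ht.trans_lt (hstrict hn2 hpt)
          rw [ha2] at h
          exact Or.inr (h.trans_eq (by norm_num))
        · have hp0 : 0 < (p⁻¹).toReal :=
            ENNReal.toReal_pos (ENNReal.inv_ne_zero.2 hpt) hpi
          left
          rw [hb]
          calc (2 : ℝ) ^ (q⁻¹).toReal < 2 ^ (1 : ℝ) :=
                Real.rpow_lt_rpow_of_exponent_lt one_lt_two (by linarith)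
            _ = 2 := Real.rpow_one 2)
    refine ⟨ht0, by linarith, hb1, hpos, hγ t, hβ t, ?_⟩
    rw [hβ, hγ, ← hn1]
    exact hlt
  have hW : ∀ t, ∀ y : Fin n → K, Function.Injective y → Ef p f y ≤ t → WcBounds f y a b t := by
    intro t y hy hE
    rw [ha, hb]
    exact wcBounds_Ef hn hp hpq f hy hE
  have h0 := hcontr _ (Ef_nonneg hp f x0) le_rfl
  have hf : f ≠ 0 := fun h => by simp [h] at hdeg
  have hit := h0.iterate hn hdeg hp (hW _) hx0 le_rfl
  obtain ⟨ξ, hξinj, hξroot, hξlim, -⟩ := h0.exists_tendsto hn hdeg hp (hW _) hx0 le_rfl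
  refine ⟨⟨ξ, hξinj, hξroot⟩, fun k => ⟨(hit k).1, fun i => ?_⟩, ⟨ξ, hξroot, hξlim⟩, fun k => ?_⟩
  · have h1 := (hW _ _ (hit k).1 (hit k).2.1).le_norm_one_add_sigmaf hn (hit k).1 i
    exact norm_pos_iff.1 (lt_of_lt_of_le (by linarith [h0.at_lt]) h1)
  · obtain ⟨hinj, hEk, -⟩ := hit k
    have hk := hcontr _ (Ef_nonneg hp f _) hEk
    have hdisj := fun i j (hij : i ≠ j) =>
      hk.disjoint_closedBall hn hinj (hW _ _ hinj le_rfl) hij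
    refine ⟨hdisj, fun i => ?_⟩
    obtain ⟨η, hηinj, hηroot, -, hηmem⟩ :=
      hk.exists_tendsto hn hdeg hp (hW _) hinj le_rfl
    refine ⟨η i, ⟨hηmem i, ?_⟩, ?_⟩
    · rw [hηroot, eval_mul, eval_prod, prod_eq_zero (mem_univ i) (by simp), mul_zero]
    · rintro z ⟨hz, hz0⟩
      obtain ⟨j, rfl⟩ := hηroot.exists_eq hf hz0
      by_contra hne
      have hij : i ≠ j := fun h => hne (h ▸ rfl)
      exact Set.disjoint_left.1 (hdisj i j hij) hz (hηmem j)
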